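/- arXiv:1701.02774 — 3 statements merged into one kernel-verified Lean document; each statement's English description precedes it below -/
import Mathlib

section
/- Let β be a (p,q)-clan with n = p+q, w = w_β, and I = I(β) its underlying involution. If (k<k') is a matching of β, then: (i) for every a with 1 ≤ a < w(k), we have w^{−1}(a) < k; and (ii) for every a with p+1 ≤ a < w(k'), we have I(w^{−1}(a)) < k. -/
noncomputable section
open scoped Classical

/-- A `(p,q)`-clan: a partial matching of `{0,…,p+q-1}` (encoded by the involution `mate`)
together with a sign (`true` = `+`, `false` = `-`) at each unmatched position, such that
`#(+) - #(-) = p - q`.  Matched positions carry the junk sign `true`. -/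
structure Clan (p q : ℕ) where
  mate : Fin (p + q) → Fin (p + q)
  mate_invol : ∀ i, mate (mate i) = i
  sign : Fin (p + q) → Bool
  sign_matched : ∀ i, mate i ≠ i → sign i = true
  plus_minus :
    (Finset.univ.filter fun i => mate i = i ∧ sign i = true).card + q
      = (Finset.univ.filter fun i => mate i = i ∧ sign i = false).card + p

namespace Clan

variable {p q r s : ℕ}

/-- position `i` carries a `+`. -/
def IsPlus (c : Clan p q) (i : Fin (p + q)) : Prop :=
  c.mate i = i ∧ c.sign i = true

/-- position `i` carries a `-`. -/
def IsMinus (c : Clan p q) (i : Fin (p + q)) : Prop :=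
  c.mate i = i ∧ c.sign i = false

/-- position `i` is the left end of a matching. -/
def IsLeft (c : Clan p q) (i : Fin (p + q)) : Prop :=
  i < c.mate i

/-- position `i` is the right end of a matching. -/
def IsRight (c : Clan p q) (i : Fin (p + q)) : Prop :=
  c.mate i < i

/-- `(i < j)` is a matching of the clan `c`. -/
def IsMatch (c : Clan p q) (i j : Fin (p + q)) : Prop :=
  i < j ∧ c.mate i = j

/-- The length `ℓ(c)` of a clan:
`ℓ(c) = Σ_{(i<j) matching} (j - i - #{matchings (s<t) with s < i < t < j})`. -/
def len (c : Clan p q) : ℤ :=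
  ∑ ij ∈ Finset.univ.filter (fun ij : Fin (p + q) × Fin (p + q) => c.IsMatch ij.1 ij.2),
    (((ij.2 : ℕ) : ℤ) - ((ij.1 : ℕ) : ℤ) -
      ((Finset.univ.filter (fun st : Fin (p + q) × Fin (p + q) =>
          c.IsMatch st.1 st.2 ∧ st.1 < ij.1 ∧ ij.1 < st.2 ∧ st.2 < ij.2)).card : ℤ))

/-- `c` and `c'` agree (same symbols, same matchings) at every position outside `S`. -/
def AgreeOutside (c c' : Clan p q) (S : Set (Fin (p + q))) : Prop :=
  ∀ i, i ∉ S → c.mate i = c'.mate i ∧ c.sign i = c'.sign i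

/-- `c'` is obtained from `c` by one of the transpositions (T.1)–(T.10). -/
def Transposition (c c' : Clan p q) : Prop :=
  -- (T.1)  +- ↦ 11
  (∃ a b, a < b ∧ c.IsPlus a ∧ c.IsMinus b ∧ c'.IsMatch a b ∧
      AgreeOutside c c' {a, b}) ∨
  -- (T.2)  -+ ↦ 11
  (∃ a b, a < b ∧ c.IsMinus a ∧ c.IsPlus b ∧ c'.IsMatch a b ∧
      AgreeOutside c c' {a, b}) ∨
  -- (T.3)  11+ ↦ 1+1
  (∃ a b d, c.IsMatch a b ∧ b < d ∧ c.IsPlus d ∧ c'.IsMatch a d ∧ c'.IsPlus b ∧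
      AgreeOutside c c' {a, b, d}) ∨
  -- (T.4)  11- ↦ 1-1
  (∃ a b d, c.IsMatch a b ∧ b < d ∧ c.IsMinus d ∧ c'.IsMatch a d ∧ c'.IsMinus b ∧
      AgreeOutside c c' {a, b, d}) ∨
  -- (T.5)  +11 ↦ 1+1
  (∃ a b d, c.IsPlus a ∧ a < b ∧ c.IsMatch b d ∧ c'.IsMatch a d ∧ c'.IsPlus b ∧
      AgreeOutside c c' {a, b, d}) ∨
  -- (T.6)  -11 ↦ 1-1
  (∃ a b d, c.IsMinus a ∧ a < b ∧ c.IsMatch b d ∧ c'.IsMatch a d ∧ c'.IsMinus b ∧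
      AgreeOutside c c' {a, b, d}) ∨
  -- (T.7)  1122 ↦ 1212
  (∃ i j k l, c.IsMatch i j ∧ j < k ∧ c.IsMatch k l ∧ c'.IsMatch i k ∧ c'.IsMatch j l ∧
      AgreeOutside c c' {i, j, k, l}) ∨
  -- (T.8)  1122 ↦ 1+-1
  (∃ i j k l, c.IsMatch i j ∧ j < k ∧ c.IsMatch k l ∧ c'.IsMatch i l ∧ c'.IsPlus j ∧
      c'.IsMinus k ∧ AgreeOutside c c' {i, j, k, l}) ∨
  -- (T.9)  1122 ↦ 1-+1
  (∃ i j k l, c.IsMatch i j ∧ j < k ∧ c.IsMatch k l ∧ c'.IsMatch i l ∧ c'.IsMinus j ∧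
      c'.IsPlus k ∧ AgreeOutside c c' {i, j, k, l}) ∨
  -- (T.10) 1212 ↦ 1221
  (∃ i j k l, i < j ∧ j < k ∧ k < l ∧ c.IsMatch i k ∧ c.IsMatch j l ∧ c'.IsMatch i l ∧
      c'.IsMatch j k ∧ AgreeOutside c c' {i, j, k, l})

/-- Bruhat order `≤` on clans: generated by transpositions. -/
def ble (c c' : Clan p q) : Prop :=
  Relation.ReflTransGen Transposition c c'

/-- Strict Bruhat order `<` on clans. -/
def blt (c c' : Clan p q) : Prop :=
  Relation.TransGen Transposition c c'

/-- Covering relation: `c ⋖ c'` iff `c < c'` and `ℓ(c') = ℓ(c) + 1`. -/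
def Covers (c c' : Clan p q) : Prop :=
  blt c c' ∧ c'.len = c.len + 1

/-- `θ` pattern contains `γ` via the strictly increasing index map `ι`. -/
def Pattern (θ : Clan r s) (γ : Clan p q) (ι : Fin (p + q) → Fin (r + s)) : Prop :=
  StrictMono ι ∧
  (∀ j, γ.mate j = j → θ.mate (ι j) = ι j ∧ θ.sign (ι j) = γ.sign j) ∧
  (∀ k l, γ.IsMatch k l → θ.IsMatch (ι k) (ι l))

/-- `φ` agrees with `θ` at every position outside the range of `ι`. -/
def AgreesWithOutside (φ θ : Clan r s) (ι : Fin (p + q) → Fin (r + s)) : Prop :=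
  ∀ m, (∀ k, ι k ≠ m) → φ.mate m = θ.mate m ∧ φ.sign m = θ.sign m

/-- `[α,γ]` interval pattern embeds into `[β,θ]` via `ι`. -/
def IntervalEmbed (α γ : Clan p q) (β θ : Clan r s)
    (ι : Fin (p + q) → Fin (r + s)) : Prop :=
  Pattern θ γ ι ∧ Pattern β α ι ∧ AgreesWithOutside β θ ι ∧
  θ.len - β.len = γ.len - α.len

/-- `θ` interval pattern contains `[α,γ]`. -/
def IntervalContains (θ : Clan r s) (α γ : Clan p q) : Prop :=
  ∃ (ι : Fin (p + q) → Fin (r + s)) (φ : Clan r s), IntervalEmbed α γ φ θ ι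

/-- `γ(i;+)` (here `i` is the number of initial positions considered, i.e. `i` is 1-indexed):
number of `+`'s plus number of matchings entirely among the first `i` positions. -/
def statPlus (c : Clan p q) (i : ℕ) : ℕ :=
  (Finset.univ.filter fun j : Fin (p + q) => (j : ℕ) < i ∧ c.IsPlus j).card +
  (Finset.univ.filter fun ab : Fin (p + q) × Fin (p + q) =>
      c.IsMatch ab.1 ab.2 ∧ (ab.2 : ℕ) < i).card

/-- `γ(i;-)`, as in `statPlus` with `-`'s. -/
def statMinus (c : Clan p q) (i : ℕ) : ℕ :=
  (Finset.univ.filter fun j : Fin (p + q) => (j : ℕ) < i ∧ c.IsMinus j).card +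
  (Finset.univ.filter fun ab : Fin (p + q) × Fin (p + q) =>
      c.IsMatch ab.1 ab.2 ∧ (ab.2 : ℕ) < i).card

/-- `γ(i;j)` (with `i < j` 1-indexed): number of matchings with left endpoint weakly left
of `i` and right endpoint strictly right of `j`. -/
def statMid (c : Clan p q) (i j : ℕ) : ℕ :=
  (Finset.univ.filter fun ab : Fin (p + q) × Fin (p + q) =>
      c.IsMatch ab.1 ab.2 ∧ (ab.1 : ℕ) < i ∧ j ≤ (ab.2 : ℕ)).card

/-- The permutation `w_c` associated to a clan `c`, 0-indexed: positions carrying a `+` or a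
left endpoint get (in left-to-right order) the values `0,…,p-1`; the remaining values
`p,…,p+q-1` are assigned, scanning left to right, to each `-` as it is encountered and to the
right end of each matching as soon as its left end is encountered. -/
def wNat (c : Clan p q) (i : Fin (p + q)) : ℕ :=
  if c.IsPlus i ∨ c.IsLeft i then
    (Finset.univ.filter fun j : Fin (p + q) => (c.IsPlus j ∨ c.IsLeft j) ∧ j < i).card
  else
    p + (Finset.univ.filter fun j : Fin (p + q) =>
        (c.IsMinus j ∨ c.IsLeft j) ∧ j < (if c.IsMinus i then i else c.mate i)).card

/-- Membership in the affine space `S_c`: the conditions (O.1)–(O.3) and (Z.1)–(Z.9). -/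
def MemS (c : Clan p q) (M : Matrix (Fin (p + q)) (Fin (p + q)) ℂ) : Prop :=
  -- (O.1)
  (∀ i j : Fin (p + q), c.mate i = i → (j : ℕ) = c.wNat i → M i j = 1) ∧
  -- (O.2)
  (∀ i i' j : Fin (p + q), c.IsMatch i i' →
      ((j : ℕ) = c.wNat i ∨ (j : ℕ) = c.wNat i') → M i j = 1) ∧
  -- (O.3)
  (∀ i i' j : Fin (p + q), c.IsMatch i i' → (j : ℕ) = c.wNat i → M i' j = -1) ∧
  (∀ i i' j : Fin (p + q), c.IsMatch i i' → (j : ℕ) = c.wNat i' → M i' j = 1) ∧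
  -- (Z.1): first p columns, rows containing a pivot (rows of +'s and of left endpoints)
  (∀ i j : Fin (p + q), (c.IsPlus i ∨ c.IsLeft i) → (j : ℕ) < p →
      (j : ℕ) ≠ c.wNat i → M i j = 0) ∧
  -- (Z.2): above a pivot, first p columns
  (∀ i x j : Fin (p + q), (c.IsPlus i ∨ c.IsLeft i) → (j : ℕ) = c.wNat i →
      x < i → M x j = 0) ∧
  -- (Z.3): between the pivot 1 and the -1 of a column
  (∀ i i' x j : Fin (p + q), c.IsMatch i i' → (j : ℕ) = c.wNat i →
      i < x → x < i' → M x j = 0) ∧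
  -- (Z.4): right of a -1, within the first p columns
  (∀ i i' j : Fin (p + q), c.IsMatch i i' → c.wNat i < (j : ℕ) → (j : ℕ) < p →
      M i' j = 0) ∧
  -- (Z.5): last q columns, rows containing a pivot (rows of -'s and of left endpoints)
  (∀ i j : Fin (p + q), c.IsMinus i → p ≤ (j : ℕ) → (j : ℕ) ≠ c.wNat i → M i j = 0) ∧
  (∀ i i' j : Fin (p + q), c.IsMatch i i' → p ≤ (j : ℕ) → (j : ℕ) ≠ c.wNat i' →
      M i j = 0) ∧
  -- (Z.6): above a pivot, last q columns
  (∀ i x j : Fin (p + q), c.IsMinus i → (j : ℕ) = c.wNat i → x < i → M x j = 0) ∧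
  (∀ i i' x j : Fin (p + q), c.IsMatch i i' → (j : ℕ) = c.wNat i' → x < i → M x j = 0) ∧
  -- (Z.7): between the pivot 1 and the second 1 of a column
  (∀ i i' x j : Fin (p + q), c.IsMatch i i' → (j : ℕ) = c.wNat i' →
      i < x → x < i' → M x j = 0) ∧
  -- (Z.8): right of a second-1-of-its-column
  (∀ i i' j : Fin (p + q), c.IsMatch i i' → c.wNat i' < (j : ℕ) → M i' j = 0) ∧
  -- (Z.9): identification for 1212 patterns
  (∀ i j k l ci ck : Fin (p + q), c.IsMatch i k → c.IsMatch j l →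
      i < j → j < k → k < l → (ci : ℕ) = c.wNat i → (ck : ℕ) = c.wNat k →
      M l ck = - M l ci)

/-- Rank of the southwest `(n-i) × p` submatrix of `M` (`i` 1-indexed from `1` to `n`). -/
def swRank (p q : ℕ) (M : Matrix (Fin (p + q)) (Fin (p + q)) ℂ) (i : ℕ) : ℕ :=
  Matrix.rank (Matrix.of fun (x : Fin (p + q - i)) (y : Fin p) =>
    M ⟨i + (x : ℕ), by have := x.isLt; omega⟩ ⟨(y : ℕ), by have := y.isLt; omega⟩)

/-- Rank of the southeast `(n-i) × q` submatrix of `M`. -/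
def seRank (p q : ℕ) (M : Matrix (Fin (p + q)) (Fin (p + q)) ℂ) (i : ℕ) : ℕ :=
  Matrix.rank (Matrix.of fun (x : Fin (p + q - i)) (y : Fin q) =>
    M ⟨i + (x : ℕ), by have := x.isLt; omega⟩ ⟨p + (y : ℕ), by have := y.isLt; omega⟩)

/-- Rank of the auxiliary matrix `M^{[i;j]}`: its first `i` columns are the first `i` columns
of `M⁻¹` with the last `q` rows zeroed out, its last `j` columns are the first `j` columns
of `M⁻¹`. -/
def auxRank (p q : ℕ) (M : Matrix (Fin (p + q)) (Fin (p + q)) ℂ) (i j : ℕ) : ℕ :=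
  Matrix.rank (Matrix.of fun (x : Fin (p + q)) (y : Fin i ⊕ Fin j) =>
    Sum.elim
      (fun a : Fin i =>
        if p ≤ (x : ℕ) then (0 : ℂ)
        else if h : (a : ℕ) < p + q then M⁻¹ x ⟨(a : ℕ), h⟩ else 0)
      (fun b : Fin j =>
        if h : (b : ℕ) < p + q then M⁻¹ x ⟨(b : ℕ), h⟩ else 0) y)

/-- The Mars–Springer variety `N_{θ,c}`: matrices of `S_c` satisfying the rank
conditions (R.1)–(R.3) attached to `θ`. -/
def MarsSpringer (θ c : Clan p q) (M : Matrix (Fin (p + q)) (Fin (p + q)) ℂ) : Prop :=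
  MemS c M ∧
  (∀ i : ℕ, 1 ≤ i → i ≤ p + q → swRank p q M i ≤ p - statPlus θ i) ∧
  (∀ i : ℕ, 1 ≤ i → i ≤ p + q → seRank p q M i ≤ q - statMinus θ i) ∧
  (∀ i j : ℕ, 1 ≤ i → i < j → j ≤ p + q → auxRank p q M i j ≤ j + statMid θ i j)

/-- The linear relations defining the coordinates `λ_{k,a}`:
`e_k + Σ_{a ≥ p} λ_{k,a} v_a = Σ_{a < p} λ_{k,a} v_a`, where `v_a` are the columns of `M`. -/
def LambdaRel (p q : ℕ) (M : Matrix (Fin (p + q)) (Fin (p + q)) ℂ)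
    (lam : Fin (p + q) → Fin (p + q) → ℂ) : Prop :=
  ∀ k x : Fin (p + q),
    (if x = k then (1 : ℂ) else 0) +
        ∑ a ∈ Finset.univ.filter (fun a : Fin (p + q) => p ≤ (a : ℕ)), lam k a * M x a
      = ∑ a ∈ Finset.univ.filter (fun a : Fin (p + q) => (a : ℕ) < p), lam k a * M x a

/-- The base point of `S_c`: all free entries set to `0`. -/
def basePoint (c : Clan p q) : Matrix (Fin (p + q)) (Fin (p + q)) ℂ :=
  Matrix.of fun i j =>
    if (j : ℕ) = c.wNat i then 1
    else if c.mate i ≠ i ∧ (j : ℕ) = c.wNat (c.mate i) then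
      (if c.mate i < i then -1 else 1)
    else 0

/-- The diagonal matrix `I_{p,q}` with `p` ones followed by `q` negative ones. -/
def Ipq (p q : ℕ) : Matrix (Fin (p + q)) (Fin (p + q)) ℂ :=
  Matrix.diagonal fun i => if (i : ℕ) < p then 1 else -1

end Clan

namespace Clan

variable {p q : ℕ}

theorem card_isLeft_eq_card_isRight (c : Clan p q) :
    (Finset.univ.filter fun i => c.IsLeft i).card =
      (Finset.univ.filter fun i => c.IsRight i).card := by
  refine Finset.card_bij' (fun i _ => c.mate i) (fun i _ => c.mate i) ?_ ?_ ?_ ?_ <;>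
    intro i <;> simp only [Finset.mem_filter] <;> simp [IsLeft, IsRight, c.mate_invol]

theorem card_isPlus_or_isLeft (c : Clan p q) :
    (Finset.univ.filter fun i => c.IsPlus i ∨ c.IsLeft i).card = p := by
  have hpl : (Finset.univ.filter fun i => c.IsPlus i ∨ c.IsLeft i).card =
      (Finset.univ.filter fun i => c.IsPlus i).card +
        (Finset.univ.filter fun i => c.IsLeft i).card := by
    rw [Finset.filter_or, Finset.card_union_of_disjoint]
    exact Finset.disjoint_filter.2 fun i _ h h' => absurd h.1 h'.ne'
  have hmr : (Finset.univ.filter fun i => ¬(c.IsPlus i ∨ c.IsLeft i)).card =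
      (Finset.univ.filter fun i => c.IsMinus i).card +
        (Finset.univ.filter fun i => c.IsRight i).card := by
    rw [← Finset.card_union_of_disjoint, ← Finset.filter_or]
    · congr 1
      ext i
      simp only [Finset.mem_filter, Finset.mem_univ, true_and]
      simp only [IsPlus, IsMinus, IsLeft, IsRight]
      rcases lt_trichotomy (c.mate i) i with h | h | h
      · simp [h, h.ne, h.not_gt]
      · simp [h]
      · simp [h, h.ne', h.not_gt]
    · exact Finset.disjoint_filter.2 fun i _ h h' => absurd h.1 (ne_of_lt h')
  have htot := Finset.card_filter_add_card_filter_not (s := Finset.univ)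
    (fun i => c.IsPlus i ∨ c.IsLeft i)
  have hlr := c.card_isLeft_eq_card_isRight
  have hsign : (Finset.univ.filter fun i => c.IsPlus i).card + q =
      (Finset.univ.filter fun i => c.IsMinus i).card + p := by
    convert c.plus_minus using 3 <;>
      (ext i; simp only [Finset.mem_filter]; rfl)
  simp only [Finset.card_univ, Fintype.card_fin] at htot
  omega

theorem wNat_of_isPlus_or_isLeft (c : Clan p q) {i : Fin (p + q)}
    (hi : c.IsPlus i ∨ c.IsLeft i) :
    c.wNat i = (Finset.univ.filter fun j => (c.IsPlus j ∨ c.IsLeft j) ∧ j < i).card :=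
  if_pos hi

theorem wNat_lt_iff (c : Clan p q) {i : Fin (p + q)} :
    c.wNat i < p ↔ c.IsPlus i ∨ c.IsLeft i := by
  refine ⟨fun h => ?_, fun hi => ?_⟩
  · by_contra hi
    rw [wNat, if_neg hi] at h
    omega
  · rw [wNat_of_isPlus_or_isLeft c hi]
    conv_rhs => rw [← c.card_isPlus_or_isLeft]
    refine Finset.card_lt_card (Finset.ssubset_iff_of_subset ?_ |>.2 ⟨i, ?_, ?_⟩)
    · exact Finset.monotone_filter_right _ fun j _ hj => hj.1
    · simpa using hi
    · simp

theorem wNat_of_not_isPlus_or_isLeft (c : Clan p q) {i : Fin (p + q)}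
    (hi : ¬(c.IsPlus i ∨ c.IsLeft i)) :
    c.wNat i =
      p + (Finset.univ.filter fun j => (c.IsMinus j ∨ c.IsLeft j) ∧ j < c.mate i).card := by
  rw [wNat, if_neg hi]
  split_ifs with h
  · rw [h.1]
  · rfl

theorem lt_of_card_filter_lt {α : Type*} [LinearOrder α] [Fintype α] {P : α → Prop} {a b : α}
    [DecidablePred fun j => P j ∧ j < a] [DecidablePred fun j => P j ∧ j < b]
    (h : (Finset.univ.filter fun j => P j ∧ j < a).card <
      (Finset.univ.filter fun j => P j ∧ j < b).card) : a < b := by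
  by_contra! hba
  exact h.not_ge <| Finset.card_le_card <|
    Finset.monotone_filter_right _ fun j _ hj => ⟨hj.1, hj.2.trans_le hba⟩

end Clan

/-- if `(k<k')` is a matching of `β` then every column value below `w(k)`
comes from a position left of `k`, and every column value in `[p, w(k'))` comes from a
position whose mate is left of `k`. -/
theorem w_matching_bounds {p q : ℕ} (β : Clan p q) (k k' : Fin (p + q))
    (h : β.IsMatch k k') :
    (∀ b : Fin (p + q), β.wNat b < β.wNat k → b < k) ∧
    (∀ b : Fin (p + q), p ≤ β.wNat b → β.wNat b < β.wNat k' → β.mate b < k) := by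
  obtain ⟨hlt, rfl⟩ := h
  have hk : β.IsPlus k ∨ β.IsLeft k := Or.inr hlt
  refine ⟨fun b hb => ?_, fun b hpb hb => ?_⟩
  · have hb' := β.wNat_lt_iff.1 (hb.trans (β.wNat_lt_iff.2 hk))
    rw [β.wNat_of_isPlus_or_isLeft hk, β.wNat_of_isPlus_or_isLeft hb'] at hb
    exact Clan.lt_of_card_filter_lt (P := fun j => β.IsPlus j ∨ β.IsLeft j) hb
  · have hb' := fun h => hpb.not_gt (β.wNat_lt_iff.2 h)
    have hk' := fun h => (hpb.trans hb.le).not_gt (β.wNat_lt_iff.2 h)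
    rw [β.wNat_of_not_isPlus_or_isLeft hb', β.wNat_of_not_isPlus_or_isLeft hk',
      β.mate_invol] at hb
    exact Clan.lt_of_card_filter_lt (P := fun j => β.IsMinus j ∨ β.IsLeft j)
      (Nat.add_lt_add_iff_left.1 hb)
end
end

section
/- Let β be a (p,q)-clan, M ∈ S_β, w = w_β, and let λ_{k,a} be the coordinates determined by M as in the context. If β_k = +, then λ_{k,w(k)} = 1. If β_k = −, then λ_{k,w(k)} = −1. -/
noncomputable section
open scoped Classical

theorem Finset.exists_card_filter_lt_eq {α : Type*} [LinearOrder α] (S : Finset α) {m : ℕ}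
    (hm : m < S.card) : ∃ i ∈ S, (S.filter (· < i)).card = m := by
  have hinj : Set.InjOn (fun i => (S.filter (· < i)).card) (S : Set α) := by
    have key : ∀ i ∈ S, ∀ j, i < j → (S.filter (· < i)).card < (S.filter (· < j)).card := by
      intro i hi j hij
      refine Finset.card_lt_card (Finset.ssubset_iff.2 ⟨i, by simp, ?_⟩)
      intro x hx
      rcases Finset.mem_insert.1 hx with rfl | hx
      · simp [hi, hij]
      · rw [Finset.mem_filter] at hx ⊢
        exact ⟨hx.1, hx.2.trans hij⟩
    intro i hi j hj h
    rcases lt_trichotomy i j with hij | hij | hij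
    · exact absurd h (key i hi j hij).ne
    · exact hij
    · exact absurd h (key j hj i hij).ne'
  have hsub : S.image (fun i => (S.filter (· < i)).card) ⊆ Finset.range S.card := by
    intro m hm
    obtain ⟨i, hi, rfl⟩ := Finset.mem_image.1 hm
    refine Finset.mem_range.2 (Finset.card_lt_card ?_)
    exact Finset.filter_ssubset.2 ⟨i, hi, lt_irrefl i⟩
  have heq := Finset.eq_of_subset_of_card_le hsub (by
    rw [Finset.card_image_of_injOn hinj, Finset.card_range])
  have : m ∈ S.image (fun i => (S.filter (· < i)).card) := heq ▸ Finset.mem_range.2 hm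
  simpa using this

namespace Clan

variable {p q : ℕ} (c : Clan p q)

theorem mate_cases (x : Fin (p + q)) : c.IsPlus x ∨ c.IsMinus x ∨ c.IsLeft x ∨ c.IsRight x := by
  unfold IsPlus IsMinus IsLeft IsRight
  rcases lt_trichotomy x (c.mate x) with h | h | h
  · simp [h]
  · cases hs : c.sign x <;> simp [← h]
  · simp [h]

theorem isMatch_of_isLeft {c : Clan p q} {x : Fin (p + q)} (h : c.IsLeft x) :
    c.IsMatch x (c.mate x) := ⟨h, rfl⟩

theorem isMatch_of_isRight {c : Clan p q} {x : Fin (p + q)} (h : c.IsRight x) :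
    c.IsMatch (c.mate x) x := ⟨h, c.mate_invol x⟩

theorem isLeft_mate {c : Clan p q} {x : Fin (p + q)} (h : c.IsRight x) : c.IsLeft (c.mate x) := by
  unfold IsLeft; rw [c.mate_invol]; exact h

theorem isRight_mate {c : Clan p q} {x : Fin (p + q)} (h : c.IsLeft x) : c.IsRight (c.mate x) := by
  unfold IsRight; rw [c.mate_invol]; exact h

theorem card_left_eq_card_right :
    (Finset.univ.filter fun i => c.IsLeft i).card
      = (Finset.univ.filter fun i => c.IsRight i).card := by
  refine Finset.card_bij' (fun i _ => c.mate i) (fun i _ => c.mate i) ?_ ?_ ?_ ?_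
  · intro i hi; simpa using isRight_mate (by simpa using hi)
  · intro i hi; simpa using isLeft_mate (by simpa using hi)
  · intro i _; exact c.mate_invol i
  · intro i _; exact c.mate_invol i

theorem card_plus_left_and_minus_left :
    (Finset.univ.filter fun i => c.IsPlus i ∨ c.IsLeft i).card = p ∧
    (Finset.univ.filter fun i => c.IsMinus i ∨ c.IsLeft i).card = q := by
  have hpm : (Finset.univ.filter fun i => c.IsPlus i).card + q
      = (Finset.univ.filter fun i => c.IsMinus i).card + p := by
    unfold IsPlus IsMinus
    convert c.plus_minus
  have hlr := c.card_left_eq_card_right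
  have h1 : (Finset.univ.filter fun i => c.IsPlus i ∨ c.IsLeft i).card
      = (Finset.univ.filter fun i => c.IsPlus i).card
        + (Finset.univ.filter fun i => c.IsLeft i).card := by
    rw [Finset.filter_or, Finset.card_union_of_disjoint]
    exact Finset.disjoint_filter.2 fun x _ h h' => h'.ne' h.1
  have h2 : (Finset.univ.filter fun i => c.IsMinus i ∨ c.IsLeft i).card
      = (Finset.univ.filter fun i => c.IsMinus i).card
        + (Finset.univ.filter fun i => c.IsLeft i).card := by
    rw [Finset.filter_or, Finset.card_union_of_disjoint]
    exact Finset.disjoint_filter.2 fun x _ h h' => h'.ne' h.1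
  have h3 : (Finset.univ.filter fun i => c.IsMinus i ∨ c.IsRight i).card
      = (Finset.univ.filter fun i => c.IsMinus i).card
        + (Finset.univ.filter fun i => c.IsRight i).card := by
    rw [Finset.filter_or, Finset.card_union_of_disjoint]
    exact Finset.disjoint_filter.2 fun x _ h h' => h'.ne h.1
  have h4 : (Finset.univ.filter fun i => c.IsPlus i ∨ c.IsLeft i).card
      + (Finset.univ.filter fun i => c.IsMinus i ∨ c.IsRight i).card = p + q := by
    rw [← Finset.card_union_of_disjoint, ← Finset.filter_or, Finset.filter_true_of_mem,
      Finset.card_univ, Fintype.card_fin]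
    · intro x _
      have := c.mate_cases x
      tauto
    · refine Finset.disjoint_filter.2 fun x _ h h' => ?_
      rcases h with h | h <;> rcases h' with h' | h'
      · simpa [h.2] using h'.2
      · exact h'.ne h.1
      · exact h.ne' h'.1
      · exact lt_asymm h h'
  omega

theorem wNat_of_plus_or_left {x : Fin (p + q)} (h : c.IsPlus x ∨ c.IsLeft x) :
    c.wNat x = ((Finset.univ.filter fun j => c.IsPlus j ∨ c.IsLeft j).filter (· < x)).card := by
  rw [wNat, if_pos h, Finset.filter_filter]

theorem wNat_of_minus {x : Fin (p + q)} (h : c.IsMinus x) :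
    c.wNat x
      = p + ((Finset.univ.filter fun j => c.IsMinus j ∨ c.IsLeft j).filter (· < x)).card := by
  have h' : ¬ (c.IsPlus x ∨ c.IsLeft x) := by
    rintro (h' | h')
    · simpa [h.2] using h'.2
    · exact h'.ne' h.1
  rw [wNat, if_neg h', if_pos h, Finset.filter_filter]

theorem wNat_of_right {x : Fin (p + q)} (h : c.IsRight x) :
    c.wNat x
      = p + ((Finset.univ.filter fun j => c.IsMinus j ∨ c.IsLeft j).filter (· < c.mate x)).card := by
  have h' : ¬ (c.IsPlus x ∨ c.IsLeft x) := by
    rintro (h' | h')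
    · exact h.ne h'.1
    · exact lt_asymm h h'
  rw [wNat, if_neg h', if_neg (fun h' => h.ne h'.1), Finset.filter_filter]

theorem wNat_lt_of_plus_or_left {x : Fin (p + q)} (h : c.IsPlus x ∨ c.IsLeft x) :
    c.wNat x < p := by
  rw [wNat_of_plus_or_left c h]
  refine lt_of_lt_of_eq (Finset.card_lt_card ?_) c.card_plus_left_and_minus_left.1
  exact Finset.filter_ssubset.2 ⟨x, by simpa using h, lt_irrefl x⟩

theorem le_wNat_of_minus_or_right {x : Fin (p + q)} (h : c.IsMinus x ∨ c.IsRight x) :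
    p ≤ c.wNat x := by
  rcases h with h | h
  · rw [wNat_of_minus c h]; omega
  · rw [wNat_of_right c h]; omega

theorem wNat_lt (x : Fin (p + q)) : c.wNat x < p + q := by
  have key : ∀ y, c.IsMinus y ∨ c.IsLeft y →
      ((Finset.univ.filter fun j => c.IsMinus j ∨ c.IsLeft j).filter (· < y)).card < q := by
    intro y hy
    refine lt_of_lt_of_eq (Finset.card_lt_card ?_) c.card_plus_left_and_minus_left.2
    exact Finset.filter_ssubset.2 ⟨y, by simpa using hy, lt_irrefl y⟩
  rcases c.mate_cases x with h | h | h | h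
  · have := c.wNat_lt_of_plus_or_left (Or.inl h); omega
  · rw [wNat_of_minus c h]; have := key x (Or.inl h); omega
  · have := c.wNat_lt_of_plus_or_left (Or.inr h); omega
  · rw [wNat_of_right c h]; have := key _ (Or.inr (isLeft_mate h)); omega

theorem exists_wNat_eq_of_lt {a : ℕ} (ha : a < p) :
    ∃ i, (c.IsPlus i ∨ c.IsLeft i) ∧ a = c.wNat i := by
  obtain ⟨i, hi, hc⟩ := Finset.exists_card_filter_lt_eq
    (Finset.univ.filter fun i => c.IsPlus i ∨ c.IsLeft i)
    (ha.trans_eq c.card_plus_left_and_minus_left.1.symm)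
  have hi : c.IsPlus i ∨ c.IsLeft i := by simpa using hi
  exact ⟨i, hi, by rw [wNat_of_plus_or_left c hi, ← hc]⟩

theorem exists_wNat_eq_of_le {a : ℕ} (ha : p ≤ a) (ha' : a < p + q) :
    ∃ i, (c.IsMinus i ∨ c.IsRight i) ∧ a = c.wNat i := by
  obtain ⟨i, hi, hc⟩ := Finset.exists_card_filter_lt_eq
    (Finset.univ.filter fun i => c.IsMinus i ∨ c.IsLeft i) (m := a - p)
    (by rw [c.card_plus_left_and_minus_left.2]; omega)
  have hi : c.IsMinus i ∨ c.IsLeft i := by simpa using hi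
  rcases hi with hi | hi
  · exact ⟨i, Or.inl hi, by rw [wNat_of_minus c hi, hc]; omega⟩
  · refine ⟨c.mate i, Or.inr (isRight_mate hi), ?_⟩
    rw [wNat_of_right c (isRight_mate hi), c.mate_invol, hc]; omega

/-- The coefficients `v` vanish on the columns of every sign and every matching of `c` lying
strictly to the left of position `x`. -/
def VanishesBefore (v : Fin (p + q) → ℂ) (x : Fin (p + q)) : Prop :=
  ∀ y < x, c.mate y ≤ y → ∀ a : Fin (p + q),
    ((a : ℕ) = c.wNat y ∨ (a : ℕ) = c.wNat (c.mate y)) → v a = 0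

variable {c} {M : Matrix (Fin (p + q)) (Fin (p + q)) ℂ} {v : Fin (p + q) → ℂ} {x a : Fin (p + q)}

theorem MemS.column_of_lt_of_mul_ne_zero (hM : MemS c M) (hv : c.VanishesBefore v x)
    (ha : (a : ℕ) < p) (hne : v a * M x a ≠ 0) :
    ((c.IsPlus x ∨ c.IsLeft x) ∧ (a : ℕ) = c.wNat x) ∨
      (c.IsRight x ∧ (a : ℕ) = c.wNat (c.mate x)) := by
  obtain ⟨-, -, -, -, -, Z2, Z3, -⟩ := hM
  have hva := left_ne_zero_of_mul hne
  have hMa := right_ne_zero_of_mul hne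
  obtain ⟨i, hi, hai⟩ := c.exists_wNat_eq_of_lt ha
  rcases lt_trichotomy x i with hxi | rfl | hix
  · exact absurd (Z2 i x a hi hai hxi) hMa
  · exact Or.inl ⟨hi, hai⟩
  rcases hi with hi | hi
  · exact absurd (hv i hix hi.1.le a (Or.inl hai)) hva
  rcases lt_trichotomy x (c.mate i) with hxm | rfl | hmx
  · exact absurd (Z3 i _ x a (isMatch_of_isLeft hi) hai hix hxm) hMa
  · exact Or.inr ⟨isRight_mate hi, by rwa [c.mate_invol]⟩
  · exact absurd (hv _ hmx (isRight_mate hi).le a (Or.inr (by rwa [c.mate_invol]))) hva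

theorem MemS.column_of_le_of_mul_ne_zero (hM : MemS c M) (hv : c.VanishesBefore v x)
    (ha : p ≤ (a : ℕ)) (hne : v a * M x a ≠ 0) :
    ((c.IsMinus x ∨ c.IsRight x) ∧ (a : ℕ) = c.wNat x) ∨
      (c.IsLeft x ∧ (a : ℕ) = c.wNat (c.mate x)) := by
  obtain ⟨-, -, -, -, -, -, -, -, -, -, Z6, Z6', Z7, -⟩ := hM
  have hva := left_ne_zero_of_mul hne
  have hMa := right_ne_zero_of_mul hne
  obtain ⟨i, hi | hi, hai⟩ := c.exists_wNat_eq_of_le ha a.isLt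
  · rcases lt_trichotomy x i with hxi | rfl | hix
    · exact absurd (Z6 i x a hi hai hxi) hMa
    · exact Or.inl ⟨Or.inl hi, hai⟩
    · exact absurd (hv i hix hi.1.le a (Or.inl hai)) hva
  · have hm := isMatch_of_isRight hi
    rcases lt_trichotomy x (c.mate i) with hxm | rfl | hmx
    · exact absurd (Z6' _ i x a hm hai hxm) hMa
    · exact Or.inr ⟨isLeft_mate hi, by rwa [c.mate_invol]⟩
    rcases lt_trichotomy x i with hxi | rfl | hix
    · exact absurd (Z7 _ i x a hm hai hmx hxi) hMa
    · exact Or.inl ⟨Or.inr hi, hai⟩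
    · exact absurd (hv i hix hi.le a (Or.inl hai)) hva

theorem MemS.sum_lt_of_plus_or_left (hM : MemS c M) (hv : c.VanishesBefore v x)
    (hx : c.IsPlus x ∨ c.IsLeft x) (ha : (a : ℕ) = c.wNat x) :
    ∑ b ∈ Finset.univ.filter (fun b : Fin (p + q) => (b : ℕ) < p), v b * M x b = v a := by
  have hMa : M x a = 1 := by
    rcases hx with hx | hx
    · exact hM.1 x a hx.1 ha
    · exact hM.2.1 x _ a (isMatch_of_isLeft hx) (Or.inl ha)
  rw [Finset.sum_eq_single a, hMa, mul_one]
  · intro b hb hba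
    by_contra hne
    rcases hM.column_of_lt_of_mul_ne_zero hv (by simpa using hb) hne with ⟨-, h⟩ | ⟨h, -⟩
    · exact hba (Fin.ext (h.trans ha.symm))
    · rcases hx with hx | hx
      · exact h.ne hx.1
      · exact lt_asymm h hx
  · intro h
    exact absurd (by simpa [ha] using c.wNat_lt_of_plus_or_left hx) h

theorem MemS.sum_lt_of_right (hM : MemS c M) (hv : c.VanishesBefore v x)
    (hx : c.IsRight x) (ha : (a : ℕ) = c.wNat (c.mate x)) :
    ∑ b ∈ Finset.univ.filter (fun b : Fin (p + q) => (b : ℕ) < p), v b * M x b = -v a := by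
  have hMa : M x a = -1 := hM.2.2.1 _ x a (isMatch_of_isRight hx) ha
  rw [Finset.sum_eq_single a, hMa, mul_neg, mul_one]
  · intro b hb hba
    by_contra hne
    rcases hM.column_of_lt_of_mul_ne_zero hv (by simpa using hb) hne with ⟨h | h, -⟩ | ⟨-, h⟩
    · exact hx.ne h.1
    · exact lt_asymm h hx
    · exact hba (Fin.ext (h.trans ha.symm))
  · intro h
    exact absurd (by simpa [ha] using c.wNat_lt_of_plus_or_left (Or.inr (isLeft_mate hx))) h

theorem MemS.sum_lt_of_minus (hM : MemS c M) (hv : c.VanishesBefore v x) (hx : c.IsMinus x) :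
    ∑ b ∈ Finset.univ.filter (fun b : Fin (p + q) => (b : ℕ) < p), v b * M x b = 0 := by
  refine Finset.sum_eq_zero fun b hb => ?_
  by_contra hne
  rcases hM.column_of_lt_of_mul_ne_zero hv (by simpa using hb) hne with ⟨h | h, -⟩ | ⟨h, -⟩
  · simpa [hx.2] using h.2
  · exact h.ne' hx.1
  · exact h.ne hx.1

theorem MemS.sum_le_of_minus_or_right (hM : MemS c M) (hv : c.VanishesBefore v x)
    (hx : c.IsMinus x ∨ c.IsRight x) (ha : (a : ℕ) = c.wNat x) :
    ∑ b ∈ Finset.univ.filter (fun b : Fin (p + q) => p ≤ (b : ℕ)), v b * M x b = v a := by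
  have hMa : M x a = 1 := by
    rcases hx with hx | hx
    · exact hM.1 x a hx.1 ha
    · exact hM.2.2.2.1 _ x a (isMatch_of_isRight hx) ha
  rw [Finset.sum_eq_single a, hMa, mul_one]
  · intro b hb hba
    by_contra hne
    rcases hM.column_of_le_of_mul_ne_zero hv (by simpa using hb) hne with ⟨-, h⟩ | ⟨h, -⟩
    · exact hba (Fin.ext (h.trans ha.symm))
    · rcases hx with hx | hx
      · exact h.ne' hx.1
      · exact lt_asymm h hx
  · intro h
    exact absurd (by simpa [ha] using c.le_wNat_of_minus_or_right hx) h

theorem MemS.sum_le_of_left (hM : MemS c M) (hv : c.VanishesBefore v x)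
    (hx : c.IsLeft x) (ha : (a : ℕ) = c.wNat (c.mate x)) :
    ∑ b ∈ Finset.univ.filter (fun b : Fin (p + q) => p ≤ (b : ℕ)), v b * M x b = v a := by
  have hMa : M x a = 1 := hM.2.1 x _ a (isMatch_of_isLeft hx) (Or.inr ha)
  rw [Finset.sum_eq_single a, hMa, mul_one]
  · intro b hb hba
    by_contra hne
    rcases hM.column_of_le_of_mul_ne_zero hv (by simpa using hb) hne with ⟨h | h, -⟩ | ⟨-, h⟩
    · exact hx.ne' h.1
    · exact lt_asymm h hx
    · exact hba (Fin.ext (h.trans ha.symm))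
  · intro h
    exact absurd (by simpa [ha] using c.le_wNat_of_minus_or_right (Or.inr (isRight_mate hx))) h

theorem MemS.sum_le_of_plus (hM : MemS c M) (hv : c.VanishesBefore v x) (hx : c.IsPlus x) :
    ∑ b ∈ Finset.univ.filter (fun b : Fin (p + q) => p ≤ (b : ℕ)), v b * M x b = 0 := by
  refine Finset.sum_eq_zero fun b hb => ?_
  by_contra hne
  rcases hM.column_of_le_of_mul_ne_zero hv (by simpa using hb) hne with ⟨h | h, -⟩ | ⟨h, -⟩
  · simpa [hx.2] using h.2
  · exact h.ne hx.1
  · exact h.ne' hx.1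

theorem MemS.vanishesBefore (hM : MemS c M) {k : Fin (p + q)}
    (hrow : ∀ x < k, ∑ b ∈ Finset.univ.filter (fun b : Fin (p + q) => p ≤ (b : ℕ)), v b * M x b
      = ∑ b ∈ Finset.univ.filter (fun b : Fin (p + q) => (b : ℕ) < p), v b * M x b) :
    c.VanishesBefore v k := by
  intro x
  induction x using WellFoundedLT.induction with
  | ind x ih =>
    intro hxk hmx a ha
    have hv : c.VanishesBefore v x := fun y hyx => ih y hyx (hyx.trans hxk)
    have hr := hrow x hxk
    rcases c.mate_cases x with h | h | h | h
    · rw [h.1, or_self] at ha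
      rw [hM.sum_le_of_plus hv h, hM.sum_lt_of_plus_or_left hv (Or.inl h) ha] at hr
      exact hr.symm
    · rw [h.1, or_self] at ha
      rwa [hM.sum_lt_of_minus hv h, hM.sum_le_of_minus_or_right hv (Or.inl h) ha] at hr
    · exact absurd h hmx.not_gt
    · have hv' : c.VanishesBefore v (c.mate x) := fun y hy => hv y (hy.trans h)
      have hr' := hrow _ (h.trans hxk)
      rw [hM.sum_le_of_minus_or_right (a := ⟨_, c.wNat_lt x⟩) hv (Or.inr h) rfl,
        hM.sum_lt_of_right (a := ⟨_, c.wNat_lt (c.mate x)⟩) hv h rfl] at hr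
      rw [hM.sum_le_of_left (a := ⟨_, c.wNat_lt x⟩) hv' (isLeft_mate h) (by rw [c.mate_invol]),
        hM.sum_lt_of_plus_or_left (a := ⟨_, c.wNat_lt (c.mate x)⟩) hv' (Or.inr (isLeft_mate h))
          rfl] at hr'
      rcases ha with ha | ha
      · rw [show a = ⟨_, c.wNat_lt x⟩ from Fin.ext ha]
        linear_combination (hr + hr') / 2
      · rw [show a = ⟨_, c.wNat_lt (c.mate x)⟩ from Fin.ext ha]
        linear_combination (hr - hr') / 2

end Clan

/-- if `β_k = +` then `λ_{k,w(k)} = 1`; if `β_k = -` then `λ_{k,w(k)} = -1`. -/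
theorem lambda_at_sign {p q : ℕ} (β : Clan p q)
    (M : Matrix (Fin (p + q)) (Fin (p + q)) ℂ) (hM : Clan.MemS β M)
    (lam : Fin (p + q) → Fin (p + q) → ℂ) (hlam : Clan.LambdaRel p q M lam)
    (k : Fin (p + q)) :
    (β.IsPlus k → ∀ a : Fin (p + q), (a : ℕ) = β.wNat k → lam k a = 1) ∧
    (β.IsMinus k → ∀ a : Fin (p + q), (a : ℕ) = β.wNat k → lam k a = -1) := by
  have hv : β.VanishesBefore (lam k) k := hM.vanishesBefore fun x hx => by
    simpa [hx.ne] using hlam k x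
  have hr := hlam k k
  rw [if_pos rfl] at hr
  refine ⟨fun hk a ha => ?_, fun hk a ha => ?_⟩
  · rw [hM.sum_le_of_plus hv hk, hM.sum_lt_of_plus_or_left hv (Or.inl hk) ha] at hr
    linear_combination -hr
  · rw [hM.sum_lt_of_minus hv hk, hM.sum_le_of_minus_or_right hv (Or.inl hk) ha] at hr
    linear_combination hr
end
end

section
/- Let β be a (p,q)-clan, M ∈ S_β, w = w_β, and let λ_{k,a} be the coordinates determined by M as in the context. If (k<k') is a matching of β, then λ_{k,w(k)} = 1/2, λ_{k,w(k')} = −1/2, and λ_{k',w(k)} = λ_{k',w(k')} = −1/2. -/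
noncomputable section
open scoped Classical

namespace Clan

/-- The number of positions strictly left of `i` satisfying `P`. -/
def countBelow {n : ℕ} (P : Fin n → Prop) (i : Fin n) : ℕ :=
  (Finset.univ.filter fun j => P j ∧ j < i).card

theorem countBelow_lt_countBelow {n : ℕ} {P : Fin n → Prop} {i j : Fin n} (hi : P i)
    (hij : i < j) : countBelow P i < countBelow P j := by
  refine Finset.card_lt_card (Finset.ssubset_iff_of_subset ?_ |>.2 ⟨i, ?_, ?_⟩)
  · intro x hx
    simp only [Finset.mem_filter, Finset.mem_univ, true_and] at hx ⊢
    exact ⟨hx.1, hx.2.trans hij⟩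
  · simp [hi, hij]
  · simp

theorem countBelow_lt_card {n : ℕ} {P : Fin n → Prop} {i : Fin n} (hi : P i) :
    countBelow P i < (Finset.univ.filter P).card := by
  refine Finset.card_lt_card (Finset.ssubset_iff_of_subset ?_ |>.2 ⟨i, ?_, ?_⟩)
  · intro x hx
    simp only [Finset.mem_filter, Finset.mem_univ, true_and] at hx ⊢
    exact hx.1
  · simp [hi]
  · simp

theorem exists_countBelow_eq {n : ℕ} (P : Fin n → Prop) {m : ℕ}
    (hm : m < (Finset.univ.filter P).card) : ∃ i, P i ∧ countBelow P i = m := by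
  have himage : (Finset.univ.filter P).image (countBelow P) =
      Finset.range (Finset.univ.filter P).card := by
    refine Finset.eq_of_subset_of_card_le ?_ ?_
    · intro x hx
      obtain ⟨i, hi, rfl⟩ := Finset.mem_image.1 hx
      exact Finset.mem_range.2 (countBelow_lt_card (by simpa using hi))
    · rw [Finset.card_range, Finset.card_image_of_injOn]
      intro i hi j hj hij
      have hi' : P i := by simpa using hi
      have hj' : P j := by simpa using hj
      rcases lt_trichotomy i j with hlt | heq | hlt
      · exact absurd hij (countBelow_lt_countBelow hi' hlt).ne
      · exact heq
      · exact absurd hij (countBelow_lt_countBelow hj' hlt).ne'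
  have hmem : m ∈ (Finset.univ.filter P).image (countBelow P) := by
    rw [himage]
    exact Finset.mem_range.2 hm
  obtain ⟨i, hi, him⟩ := Finset.mem_image.1 hmem
  exact ⟨i, by simpa using hi, him⟩

/-- Positions carrying a `+` or a left endpoint: the pivot rows of the first `p` columns. -/
def IsPos {p q : ℕ} (c : Clan p q) (i : Fin (p + q)) : Prop :=
  c.IsPlus i ∨ c.IsLeft i

/-- Positions carrying a `-` or a left endpoint: the pivot rows of the last `q` columns. -/
def IsNeg {p q : ℕ} (c : Clan p q) (i : Fin (p + q)) : Prop :=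
  c.IsMinus i ∨ c.IsLeft i

theorem card_isPos_and_card_isNeg {p q : ℕ} (c : Clan p q) :
    (Finset.univ.filter c.IsPos).card = p ∧ (Finset.univ.filter c.IsNeg).card = q := by
  have hpos : (Finset.univ.filter c.IsPos).card =
      (Finset.univ.filter c.IsPlus).card + (Finset.univ.filter c.IsLeft).card := by
    rw [← Finset.card_union_of_disjoint, ← Finset.filter_or]
    · exact congrArg Finset.card (Finset.ext fun i => by simp only [Finset.mem_filter]; rfl)
    · refine Finset.disjoint_filter.2 fun i _ h h' => ?_
      exact absurd h.1 (ne_of_gt h')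
  have hneg : (Finset.univ.filter c.IsNeg).card =
      (Finset.univ.filter c.IsMinus).card + (Finset.univ.filter c.IsLeft).card := by
    rw [← Finset.card_union_of_disjoint, ← Finset.filter_or]
    · exact congrArg Finset.card (Finset.ext fun i => by simp only [Finset.mem_filter]; rfl)
    · refine Finset.disjoint_filter.2 fun i _ h h' => ?_
      exact absurd h.1 (ne_of_gt h')
  have hright : (Finset.univ.filter c.IsRight).card = (Finset.univ.filter c.IsLeft).card := by
    refine Finset.card_nbij' c.mate c.mate ?_ ?_ ?_ ?_ <;> intro i hi
    · simpa [IsLeft, IsRight, c.mate_invol] using hi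
    · simpa [IsLeft, IsRight, c.mate_invol] using hi
    · exact c.mate_invol i
    · exact c.mate_invol i
  have htotal := Finset.card_filter_add_card_filter_not (s := Finset.univ) c.IsPos
  have hcompl : (Finset.univ.filter fun i => ¬ c.IsPos i).card =
      (Finset.univ.filter c.IsMinus).card + (Finset.univ.filter c.IsRight).card := by
    rw [← Finset.card_union_of_disjoint, ← Finset.filter_or]
    · congr 1
      ext i
      simp only [Finset.mem_filter, Finset.mem_univ, true_and]
      simp only [IsPos, IsPlus, IsMinus, IsLeft, IsRight]
      rcases lt_trichotomy (c.mate i) i with h | h | h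
      · simp [h, h.ne, h.le]
      · simp [h]
      · simp [h, h.ne', h.le]
    · refine Finset.disjoint_filter.2 fun i _ h h' => ?_
      exact absurd h.1 (ne_of_lt h')
  have hpm : (Finset.univ.filter c.IsPlus).card + q =
      (Finset.univ.filter c.IsMinus).card + p := by
    have hplus : Finset.univ.filter c.IsPlus =
        Finset.univ.filter fun i => c.mate i = i ∧ c.sign i = true :=
      Finset.ext fun i => by simp only [Finset.mem_filter]; rfl
    have hminus : Finset.univ.filter c.IsMinus =
        Finset.univ.filter fun i => c.mate i = i ∧ c.sign i = false :=
      Finset.ext fun i => by simp only [Finset.mem_filter]; rfl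
    rw [hplus, hminus]
    exact c.plus_minus
  rw [Finset.card_univ, Fintype.card_fin] at htotal
  omega

theorem IsPos.countBelow_lt {p q : ℕ} {c : Clan p q} {i : Fin (p + q)} (h : c.IsPos i) :
    countBelow c.IsPos i < p :=
  (countBelow_lt_card h).trans_eq c.card_isPos_and_card_isNeg.1

theorem IsNeg.countBelow_lt {p q : ℕ} {c : Clan p q} {i : Fin (p + q)} (h : c.IsNeg i) :
    countBelow c.IsNeg i < q :=
  (countBelow_lt_card h).trans_eq c.card_isPos_and_card_isNeg.2

/-- A left endpoint owns a pivot column on either side. -/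
theorem IsLeft.exists_columns {p q : ℕ} {c : Clan p q} {i : Fin (p + q)} (h : c.IsLeft i) :
    ∃ a a' : Fin (p + q), (a : ℕ) = countBelow c.IsPos i ∧
      (a' : ℕ) = p + countBelow c.IsNeg i := by
  have hpos := IsPos.countBelow_lt (c := c) (Or.inr h)
  have hneg := IsNeg.countBelow_lt (c := c) (Or.inr h)
  exact ⟨⟨_, hpos.trans_le (Nat.le_add_right p q)⟩, ⟨_, Nat.add_lt_add_left hneg p⟩, rfl, rfl⟩

theorem wNat_of_isPos {p q : ℕ} {c : Clan p q} {i : Fin (p + q)} (h : c.IsPos i) :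
    c.wNat i = countBelow c.IsPos i := by
  have h' : c.IsPlus i ∨ c.IsLeft i := h
  rw [wNat, if_pos h', countBelow]
  exact congrArg Finset.card (Finset.ext fun j => by simp only [Finset.mem_filter]; rfl)

theorem wNat_of_isMinus {p q : ℕ} {c : Clan p q} {i : Fin (p + q)} (h : c.IsMinus i) :
    c.wNat i = p + countBelow c.IsNeg i := by
  have h' : ¬ (c.IsPlus i ∨ c.IsLeft i) := by
    simp [IsPlus, IsLeft, h.1, h.2]
  rw [wNat, if_neg h', if_pos h, countBelow]
  congr 2
  exact Finset.ext fun j => by simp only [Finset.mem_filter]; rfl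

theorem wNat_mate_of_isLeft {p q : ℕ} {c : Clan p q} {i : Fin (p + q)} (h : c.IsLeft i) :
    c.wNat (c.mate i) = p + countBelow c.IsNeg i := by
  have hlt : i < c.mate i := h
  have h' : ¬ (c.IsPlus (c.mate i) ∨ c.IsLeft (c.mate i)) := by
    simp [IsPlus, IsLeft, c.mate_invol, hlt.ne, hlt.le]
  have h'' : ¬ c.IsMinus (c.mate i) := by
    simp [IsMinus, c.mate_invol, hlt.ne]
  rw [wNat, if_neg h', if_neg h'', c.mate_invol, countBelow]
  congr 2
  exact Finset.ext fun j => by simp only [Finset.mem_filter]; rfl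

section MemS

variable {p q : ℕ} {c : Clan p q} {M : Matrix (Fin (p + q)) (Fin (p + q)) ℂ}

/-- The first `p` columns with pivot right of `b` vanish in the rows `b` and `mate b`. -/
theorem MemS.eq_zero_of_isPos (hM : c.MemS M) {b x y a : Fin (p + q)} (hb : b ≤ c.mate b)
    (hx : x = b ∨ x = c.mate b) (hy : c.IsPos y) (ha : (a : ℕ) = countBelow c.IsPos y)
    (hby : b < y) : M x a = 0 := by
  obtain ⟨-, -, -, -, -, hZ2, -, hZ4, -⟩ := hM
  by_cases hxb : x = b
  · exact hZ2 y x a hy (ha.trans (wNat_of_isPos hy).symm) (hxb ▸ hby)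
  · obtain rfl : x = c.mate b := hx.resolve_left hxb
    have hleft : b < c.mate b := lt_of_le_of_ne hb (Ne.symm hxb)
    have hpos : c.IsPos b := Or.inr hleft
    refine hZ4 b _ a ⟨hleft, rfl⟩ ?_ ?_
    · rw [wNat_of_isPos hpos, ha]
      exact countBelow_lt_countBelow hpos hby
    · exact ha.trans_lt hy.countBelow_lt

/-- The last `q` columns with pivot right of `b` vanish in the rows `b` and `mate b`. -/
theorem MemS.eq_zero_of_isNeg (hM : c.MemS M) {b x y a : Fin (p + q)} (hb : b ≤ c.mate b)
    (hx : x = b ∨ x = c.mate b) (hy : c.IsNeg y) (ha : (a : ℕ) = p + countBelow c.IsNeg y)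
    (hby : b < y) : M x a = 0 := by
  obtain ⟨-, -, -, -, -, -, -, -, -, -, hZ6, hZ6', -, hZ8, -⟩ := hM
  by_cases hxb : x = b
  · rcases hy with hy | hy
    · exact hZ6 y x a hy (ha.trans (wNat_of_isMinus hy).symm) (hxb ▸ hby)
    · exact hZ6' y _ x a ⟨hy, rfl⟩ (ha.trans (wNat_mate_of_isLeft hy).symm) (hxb ▸ hby)
  · obtain rfl : x = c.mate b := hx.resolve_left hxb
    have hleft : b < c.mate b := lt_of_le_of_ne hb (Ne.symm hxb)
    refine hZ8 b _ a ⟨hleft, rfl⟩ ?_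
    rw [wNat_mate_of_isLeft hleft, ha]
    exact Nat.add_lt_add_left (countBelow_lt_countBelow (Or.inr hleft) hby) p

/-- The coefficients `l` vanish on the columns whose pivot lies in row `y`. -/
def VanishesAt (c : Clan p q) (l : Fin (p + q) → ℂ) (y : Fin (p + q)) : Prop :=
  ∀ a : Fin (p + q), (c.IsPos y ∧ (a : ℕ) = countBelow c.IsPos y) ∨
    (c.IsNeg y ∧ (a : ℕ) = p + countBelow c.IsNeg y) → l a = 0

/-- In the rows `b` and `mate b`, a first-`p`-columns term can be nonzero only in the column
with pivot in row `b`, once the coefficients vanish at all earlier pivots. -/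
theorem MemS.mul_eq_zero_of_lt (hM : c.MemS M) {b x : Fin (p + q)} (hb : b ≤ c.mate b)
    (hx : x = b ∨ x = c.mate b) {l : Fin (p + q) → ℂ} (hl : ∀ y < b, c.VanishesAt l y)
    {a : Fin (p + q)} (ha : (a : ℕ) < p)
    (hab : c.IsPos b → (a : ℕ) ≠ countBelow c.IsPos b) : l a * M x a = 0 := by
  obtain ⟨y, hy, hya⟩ := exists_countBelow_eq c.IsPos
    (m := a) (by rw [c.card_isPos_and_card_isNeg.1]; exact ha)
  rcases lt_trichotomy y b with h | rfl | h
  · rw [hl y h a (Or.inl ⟨hy, hya.symm⟩), zero_mul]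
  · exact absurd hya.symm (hab hy)
  · rw [hM.eq_zero_of_isPos hb hx hy hya.symm h, mul_zero]

/-- In the rows `b` and `mate b`, a last-`q`-columns term can be nonzero only in the column
with pivot in row `b`, once the coefficients vanish at all earlier pivots. -/
theorem MemS.mul_eq_zero_of_le (hM : c.MemS M) {b x : Fin (p + q)} (hb : b ≤ c.mate b)
    (hx : x = b ∨ x = c.mate b) {l : Fin (p + q) → ℂ} (hl : ∀ y < b, c.VanishesAt l y)
    {a : Fin (p + q)} (ha : p ≤ (a : ℕ))
    (hab : c.IsNeg b → (a : ℕ) ≠ p + countBelow c.IsNeg b) : l a * M x a = 0 := by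
  obtain ⟨y, hy, hya⟩ := exists_countBelow_eq c.IsNeg
    (m := a - p) (by rw [c.card_isPos_and_card_isNeg.2]; omega)
  have hya' : (a : ℕ) = p + countBelow c.IsNeg y := by omega
  rcases lt_trichotomy y b with h | rfl | h
  · rw [hl y h a (Or.inr ⟨hy, hya'⟩), zero_mul]
  · exact absurd hya' (hab hy)
  · rw [hM.eq_zero_of_isNeg hb hx hy hya' h, mul_zero]

theorem MemS.sum_lt_eq_single (hM : c.MemS M) {b x a : Fin (p + q)} (hb : b ≤ c.mate b)
    (hx : x = b ∨ x = c.mate b) {l : Fin (p + q) → ℂ} (hl : ∀ y < b, c.VanishesAt l y)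
    (hpos : c.IsPos b) (ha : (a : ℕ) = countBelow c.IsPos b) :
    ∑ a ∈ Finset.univ.filter (fun a : Fin (p + q) => (a : ℕ) < p), l a * M x a
      = l a * M x a := by
  have hap : (a : ℕ) < p := ha.trans_lt hpos.countBelow_lt
  refine Finset.sum_eq_single_of_mem a (by simpa using hap) fun a' ha' hne => ?_
  refine hM.mul_eq_zero_of_lt hb hx hl (by simpa using ha') fun _ h => hne (Fin.ext ?_)
  rw [h, ha]

theorem MemS.sum_le_eq_single (hM : c.MemS M) {b x a : Fin (p + q)} (hb : b ≤ c.mate b)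
    (hx : x = b ∨ x = c.mate b) {l : Fin (p + q) → ℂ} (hl : ∀ y < b, c.VanishesAt l y)
    (ha : (a : ℕ) = p + countBelow c.IsNeg b) :
    ∑ a ∈ Finset.univ.filter (fun a : Fin (p + q) => p ≤ (a : ℕ)), l a * M x a
      = l a * M x a := by
  refine Finset.sum_eq_single_of_mem a (by simp [ha]) fun a' ha' hne => ?_
  refine hM.mul_eq_zero_of_le hb hx hl (by simpa using ha') fun _ h => hne (Fin.ext ?_)
  rw [h, ha]

/-- The row equations of a matching, once the coefficients vanish at all earlier pivots. -/
theorem MemS.matching_equations (hM : c.MemS M) {lam : Fin (p + q) → Fin (p + q) → ℂ}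
    (hlam : LambdaRel p q M lam) {s b a a' : Fin (p + q)} (hb : c.IsLeft b)
    (hl : ∀ y < b, c.VanishesAt (lam s) y) (ha : (a : ℕ) = countBelow c.IsPos b)
    (ha' : (a' : ℕ) = p + countBelow c.IsNeg b) :
    (if b = s then (1 : ℂ) else 0) + lam s a' = lam s a ∧
      (if c.mate b = s then (1 : ℂ) else 0) + lam s a' = -lam s a := by
  have hble : b ≤ c.mate b := le_of_lt hb
  have hpos : c.IsPos b := Or.inr hb
  have hw : (a : ℕ) = c.wNat b := ha.trans (wNat_of_isPos hpos).symm
  have hw' : (a' : ℕ) = c.wNat (c.mate b) := ha'.trans (wNat_mate_of_isLeft hb).symm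
  have hmatch : c.IsMatch b (c.mate b) := ⟨hb, rfl⟩
  have hrow := hlam s b
  have hrow' := hlam s (c.mate b)
  rw [hM.sum_lt_eq_single hble (Or.inl rfl) hl hpos ha,
    hM.sum_le_eq_single hble (Or.inl rfl) hl ha'] at hrow
  rw [hM.sum_lt_eq_single hble (Or.inr rfl) hl hpos ha,
    hM.sum_le_eq_single hble (Or.inr rfl) hl ha'] at hrow'
  obtain ⟨-, hO2, hO3, hO3', -⟩ := hM
  rw [hO2 b _ a hmatch (Or.inl hw), hO2 b _ a' hmatch (Or.inr hw'), mul_one, mul_one] at hrow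
  rw [hO3 b _ a hmatch hw, hO3' b _ a' hmatch hw', mul_one, mul_neg_one] at hrow'
  exact ⟨hrow, hrow'⟩

/-- `λ_s` vanishes on every column whose pivot lies left of the symbol at `s`. -/
theorem MemS.vanishesAt_of_lt (hM : c.MemS M) {lam : Fin (p + q) → Fin (p + q) → ℂ}
    (hlam : LambdaRel p q M lam) {s b : Fin (p + q)} (hs : b < s) (hs' : b < c.mate s) :
    c.VanishesAt (lam s) b := by
  induction b using WellFoundedLT.induction with
  | ind b ih =>
    have hl : ∀ y < b, c.VanishesAt (lam s) y := fun y hy => ih y hy (hy.trans hs) (hy.trans hs')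
    by_cases hleft : c.IsLeft b
    · have hne : c.mate b ≠ s := by
        rintro rfl
        rw [c.mate_invol] at hs'
        exact lt_irrefl _ hs'
      obtain ⟨a₀, a₁, ha₀, ha₁⟩ := IsLeft.exists_columns hleft
      obtain ⟨h₁, h₂⟩ := hM.matching_equations hlam (s := s) hleft hl ha₀ ha₁
      rw [if_neg hs.ne, zero_add] at h₁
      rw [if_neg hne, zero_add] at h₂
      rintro a (⟨-, ha⟩ | ⟨-, ha⟩)
      · obtain rfl : a = a₀ := Fin.ext (ha.trans ha₀.symm)
        linear_combination (-1 / 2) * h₁ + (1 / 2) * h₂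
      · obtain rfl : a = a₁ := Fin.ext (ha.trans ha₁.symm)
        linear_combination (1 / 2) * h₁ + (1 / 2) * h₂
    · have hrow := hlam s b
      rw [if_neg hs.ne, zero_add] at hrow
      rintro a (⟨hpos, ha⟩ | ⟨hneg, ha⟩)
      · have hplus : c.IsPlus b := hpos.resolve_right hleft
        have hb : b ≤ c.mate b := hplus.1.ge
        rw [hM.sum_lt_eq_single hb (Or.inl rfl) hl hpos ha, Finset.sum_eq_zero,
          hM.1 b a hplus.1 (ha.trans (wNat_of_isPos hpos).symm), mul_one] at hrow
        · exact hrow.symm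
        · refine fun a' ha' => hM.mul_eq_zero_of_le hb (Or.inl rfl) hl (by simpa using ha') ?_
          exact fun hneg => absurd (hneg.resolve_right hleft).2 (by simp [hplus.2])
      · have hminus : c.IsMinus b := hneg.resolve_right hleft
        have hb : b ≤ c.mate b := hminus.1.ge
        rw [hM.sum_le_eq_single hb (Or.inl rfl) hl ha, Finset.sum_eq_zero,
          hM.1 b a hminus.1 (ha.trans (wNat_of_isMinus hminus).symm), mul_one] at hrow
        · exact hrow
        · refine fun a' ha' => hM.mul_eq_zero_of_lt hb (Or.inl rfl) hl (by simpa using ha') ?_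
          exact fun hpos => absurd (hpos.resolve_right hleft).2 (by simp [hminus.2])

end MemS

end Clan

/-- for a matching `(k<k')` of `β`: `λ_{k,w(k)} = 1/2`,
`λ_{k,w(k')} = -1/2`, and `λ_{k',w(k)} = λ_{k',w(k')} = -1/2`. -/
theorem lambda_at_matching {p q : ℕ} (β : Clan p q)
    (M : Matrix (Fin (p + q)) (Fin (p + q)) ℂ) (hM : Clan.MemS β M)
    (lam : Fin (p + q) → Fin (p + q) → ℂ) (hlam : Clan.LambdaRel p q M lam)
    (k k' : Fin (p + q)) (h : β.IsMatch k k') :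
    (∀ a : Fin (p + q), (a : ℕ) = β.wNat k →
        lam k a = 1 / 2 ∧ lam k' a = -(1 / 2)) ∧
    (∀ a : Fin (p + q), (a : ℕ) = β.wNat k' →
        lam k a = -(1 / 2) ∧ lam k' a = -(1 / 2)) := by
  obtain ⟨hlt, rfl⟩ := h
  have hleft : β.IsLeft k := hlt
  have hpos : β.IsPos k := Or.inr hleft
  obtain ⟨a₀, a₁, ha₀, ha₁⟩ := Clan.IsLeft.exists_columns hleft
  obtain ⟨h₁, h₂⟩ := hM.matching_equations hlam (s := k) hleft
    (fun y hy => hM.vanishesAt_of_lt hlam hy (hy.trans hlt)) ha₀ ha₁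
  obtain ⟨h₃, h₄⟩ := hM.matching_equations hlam (s := β.mate k) hleft
    (fun y hy => hM.vanishesAt_of_lt hlam (hy.trans hlt) (by rwa [β.mate_invol])) ha₀ ha₁
  rw [if_pos rfl] at h₁ h₄
  rw [if_neg hlt.ne'] at h₂
  rw [if_neg hlt.ne] at h₃
  refine ⟨fun a ha => ?_, fun a ha => ?_⟩
  · obtain rfl : a = a₀ := Fin.ext (by rw [ha, ha₀, Clan.wNat_of_isPos hpos])
    exact ⟨by linear_combination (-1 / 2) * h₁ + (1 / 2) * h₂,
      by linear_combination (-1 / 2) * h₃ + (1 / 2) * h₄⟩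
  · obtain rfl : a = a₁ := Fin.ext (by rw [ha, ha₁, Clan.wNat_mate_of_isLeft hleft])
    exact ⟨by linear_combination (1 / 2) * h₁ + (1 / 2) * h₂,
      by linear_combination (1 / 2) * h₃ + (1 / 2) * h₄⟩
end
end
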